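/- Let N ≥ 1 and let w : Fin N → ℝ be non-negative (w i ≥ 0 for all i) and non-increasing. For every utility vector U : Fin N → ℝ, every index i, and every real u ≥ 0, one has G_w(U) ≤ G_w(update U i (U i + u)); i.e., the weighted Gini social-evaluation function is locally monotonically non-decreasing. -/

import Mathlib

open Finset Matrix

/-- The weighted Gini social-evaluation function: `G_w(U) = ∑ i, w i * Φ_i(U)`,
where `Φ_i(U)` is the `(i+1)`-th smallest entry of `U`. -/
noncomputable def gini {N : ℕ} (w U : Fin N → ℝ) : ℝ :=
  ∑ i, w i * U (Tuple.sort U i)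

/-- The weighted Gini function with non-increasing weights is a lower bound for the weighted sum
of the utilities taken in any order. -/
theorem gini_le_sum_mul_comp_perm {N : ℕ} {w : Fin N → ℝ} (hw : Antitone w) (U : Fin N → ℝ)
    (σ : Equiv.Perm (Fin N)) : gini w U ≤ ∑ j, w j * U (σ j) := by
  have h := (hw.antivary (Tuple.monotone_sort U)).sum_mul_le_sum_mul_comp_perm
    (σ := σ.trans (Tuple.sort U).symm)
  simpa [gini] using h

/-- The weighted Gini function with non-negative non-increasing weights is monotone. -/
theorem gini_mono {N : ℕ} {w : Fin N → ℝ} (hw_nonneg : ∀ i, 0 ≤ w i) (hw : Antitone w) :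
    Monotone (gini w) := fun U V hUV =>
  (gini_le_sum_mul_comp_perm hw U (Tuple.sort V)).trans <|
    Finset.sum_le_sum fun j _ => mul_le_mul_of_nonneg_left (hUV _) (hw_nonneg j)

theorem stmt_1 (N : ℕ) (hN : 1 ≤ N) (w : Fin N → ℝ)
    (hw_nonneg : ∀ i, 0 ≤ w i) (hw_anti : Antitone w)
    (U : Fin N → ℝ) (i : Fin N) (u : ℝ) (hu : 0 ≤ u) :
    gini w U ≤ gini w (Function.update U i (U i + u)) := by
  exact gini_mono hw_nonneg hw_anti (le_update_self_iff.2 (le_add_of_nonneg_right hu))
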